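/- arXiv:cs/0001027 — 3 statements merged into one kernel-verified Lean document; each statement's English description precedes it below -/
import Mathlib

section
/- ε-machines are deterministic: there exists a function f : range(S_0) × A → range(S_0) such that μ-almost surely S_1 = f(S_0, X_0); that is, the causal state at time 1 is almost surely determined by the causal state at time 0 together with the symbol emitted at time 0. -/
open MeasureTheory ProbabilityTheory

noncomputable section

/-- Shannon entropy (in bits) of a random variable `U`. -/
def ent {Ω S : Type*} [MeasurableSpace Ω] (μ : Measure Ω) (U : Ω → S) : ℝ :=
  ∑' s : S, -((μ (U ⁻¹' {s})).toReal * Real.logb 2 (μ (U ⁻¹' {s})).toReal)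

/-- The entropy series of `U` is summable (i.e. `U` has finite entropy). -/
def entSummable {Ω S : Type*} [MeasurableSpace Ω] (μ : Measure Ω) (U : Ω → S) : Prop :=
  Summable (fun s : S => -((μ (U ⁻¹' {s})).toReal * Real.logb 2 (μ (U ⁻¹' {s})).toReal))

/-- Conditional Shannon entropy (in bits) H[U|V]. -/
def condEnt {Ω S T : Type*} [MeasurableSpace Ω] (μ : Measure Ω) (U : Ω → S) (V : Ω → T) : ℝ :=
  ent μ (fun ω => (U ω, V ω)) - ent μ V

/-- Mutual information (in bits) I[U;V]. -/
def mutInf {Ω S T : Type*} [MeasurableSpace Ω] (μ : Measure Ω) (U : Ω → S) (V : Ω → T) : ℝ :=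
  ent μ U + ent μ V - ent μ (fun ω => (U ω, V ω))

variable (A : Type*) [Fintype A] [MeasurableSpace A] [MeasurableSingletonClass A]

/-- The left shift on bi-infinite sequences. -/
def shift : (ℤ → A) → (ℤ → A) := fun ω t => ω (t + 1)

/-- The infinite future `(ω_0, ω_1, …)`. -/
def Future : (ℤ → A) → (ℕ → A) := fun ω n => ω (n : ℤ)

/-- The length-`L` future block `(X_0, …, X_{L-1})`. -/
def FutureBlk (L : ℕ) : (ℤ → A) → (Fin L → A) := fun ω i => ω ((i : ℕ) : ℤ)

/-- The length-`M` past block `(X_{-M}, …, X_{-1})`. -/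
def PastBlk (M : ℕ) : (ℤ → A) → (Fin M → A) := fun ω i => ω (((i : ℕ) : ℤ) - (M : ℤ))

/-- The infinite past at time `t`: `(ω_{t-1}, ω_{t-2}, …)`. -/
def PastAt (t : ℤ) : (ℤ → A) → (ℕ → A) := fun ω n => ω (t - 1 - (n : ℤ))

/-- The infinite past at time `0`. -/
abbrev Past : (ℤ → A) → (ℕ → A) := PastAt A 0

/-- `H[Future^L | Past] := inf_{M ≥ 1} H[Future^L | Past^M]`. -/
def condEntPast (μ : Measure (ℤ → A)) (L : ℕ) : ℝ :=
  ⨅ M : ℕ, condEnt μ (FutureBlk A L) (PastBlk A (M + 1))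

variable [Nontrivial A]

/-- The causal state at time `t`: the regular conditional distribution of the
future given the past, evaluated on the past at time `t`. -/
def causalState (μ : Measure (ℤ → A)) [IsFiniteMeasure μ] (t : ℤ) :
    (ℤ → A) → Measure (ℕ → A) :=
  fun ω => condDistrib (Future A) (Past A) μ (PastAt A t ω)

end

section Determinism

variable {A : Type*}

/-- Prepend a symbol to a one-sided sequence. -/
def seqCons (a : A) (p : ℕ → A) : ℕ → A
  | 0 => a
  | n + 1 => p n

/-- Drop the first symbol of a one-sided sequence. -/
def seqTail (x : ℕ → A) : ℕ → A := fun n => x (n + 1)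

lemma seqTail_seqCons (a : A) (p : ℕ → A) : seqTail (seqCons a p) = p := rfl

lemma seqCons_zero (a : A) (p : ℕ → A) : seqCons a p 0 = a := rfl

lemma PastAt_zero_shift (ω : ℤ → A) : PastAt A 0 (shift A ω) = PastAt A 1 ω := by
  funext n
  simp only [PastAt, shift]
  congr 1
  ring

lemma PastAt_one (ω : ℤ → A) :
    PastAt A 1 ω = seqCons (Future A ω 0) (PastAt A 0 ω) := by
  funext n
  cases n with
  | zero => simp [PastAt, seqCons, Future]
  | succ n =>
    simp only [PastAt, seqCons]
    congr 1
    push_cast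
    ring

lemma Future_shift (ω : ℤ → A) : Future A (shift A ω) = seqTail (Future A ω) := by
  funext n
  simp [Future, shift, seqTail]

variable [MeasurableSpace A]

lemma measurable_seqCons :
    Measurable fun z : A × (ℕ → A) => seqCons z.1 z.2 := by
  refine measurable_pi_iff.2 fun n => ?_
  cases n with
  | zero => exact measurable_fst
  | succ n => exact (measurable_pi_apply n).comp measurable_snd

lemma measurable_seqTail : Measurable (seqTail : (ℕ → A) → ℕ → A) :=
  measurable_pi_iff.2 fun n => measurable_pi_apply (n + 1)

/-- The law of the tail of a random sequence conditioned on its first symbol. -/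
noncomputable def tailGivenHead (ν : Measure (ℕ → A)) (a : A) : Measure (ℕ → A) :=
  (ν[|{x | x 0 = a}]).map seqTail

lemma measurable_shift : Measurable (shift A) :=
  measurable_pi_iff.2 fun t => measurable_pi_apply (t + 1)

lemma measurable_Future : Measurable (Future A) :=
  measurable_pi_iff.2 fun n => measurable_pi_apply (n : ℤ)

lemma measurable_PastAt (t : ℤ) : Measurable (PastAt A t) :=
  measurable_pi_iff.2 fun n => measurable_pi_apply (t - 1 - (n : ℤ))

variable [MeasurableSingletonClass A]

lemma measurableSet_head_eq (a : A) : MeasurableSet {x : ℕ → A | x 0 = a} :=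
  (measurable_pi_apply (X := fun _ : ℕ => A) 0) (measurableSet_singleton a)

lemma tailGivenHead_apply (ν : Measure (ℕ → A)) (a : A) {s : Set (ℕ → A)}
    (hs : MeasurableSet s) :
    tailGivenHead ν a s = (ν {x | x 0 = a})⁻¹ * ν ({x | x 0 = a} ∩ seqTail ⁻¹' s) := by
  rw [tailGivenHead, Measure.map_apply measurable_seqTail hs,
    cond_apply (measurableSet_head_eq a)]

lemma lintegral_tailGivenHead [Fintype A] (ν : Measure (ℕ → A)) [IsFiniteMeasure ν]
    {G : A → Set (ℕ → A)} (hG : ∀ a, MeasurableSet (G a)) :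
    ∫⁻ x, tailGivenHead ν (x 0) (G (x 0)) ∂ν = ν {x | seqTail x ∈ G (x 0)} := by
  have hmap : ∫⁻ x, tailGivenHead ν (x 0) (G (x 0)) ∂ν =
      ∑ a, tailGivenHead ν a (G a) * ν {x | x 0 = a} := by
    rw [← lintegral_map (f := fun a => tailGivenHead ν a (G a)) (measurable_of_finite _)
      (measurable_pi_apply 0), lintegral_fintype]
    refine Finset.sum_congr rfl fun a _ => ?_
    rw [Measure.map_apply (measurable_pi_apply 0) (measurableSet_singleton a)]
    rfl
  have hunion : {x : ℕ → A | seqTail x ∈ G (x 0)} =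
      ⋃ a ∈ (Finset.univ : Finset A), {x | x 0 = a} ∩ seqTail ⁻¹' G a := by
    ext x
    simp
  rw [hmap, hunion, measure_biUnion_finset]
  · refine Finset.sum_congr rfl fun a _ => ?_
    rw [tailGivenHead, Measure.map_apply measurable_seqTail (hG a),
      cond_mul_eq_inter (measurableSet_head_eq a)]
  · intro a _ b _ hab
    refine Set.disjoint_left.2 fun x hx hx' => hab ?_
    exact hx.1.symm.trans hx'.1
  · exact fun a _ => (measurableSet_head_eq a).inter (measurable_seqTail (hG a))

lemma measurable_tailGivenHead [Fintype A] (κ : Kernel (ℕ → A) (ℕ → A)) [IsFiniteKernel κ] :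
    Measurable fun p : ℕ → A => tailGivenHead (κ (seqTail p)) (p 0) := by
  refine Measure.measurable_of_measurable_coe _ fun s hs => ?_
  simp only [tailGivenHead_apply _ _ hs]
  have hE : MeasurableSet {z : (ℕ → A) × (ℕ → A) | z.2 0 = z.1 0} :=
    measurableSet_eq_fun ((measurable_pi_apply 0).comp measurable_snd)
      ((measurable_pi_apply 0).comp measurable_fst)
  refine Measurable.mul (Measurable.inv ?_) ?_
  · exact Kernel.measurable_kernel_prodMk_left (κ := κ.comap seqTail measurable_seqTail) hE
  · exact Kernel.measurable_kernel_prodMk_left (κ := κ.comap seqTail measurable_seqTail)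
      (hE.inter (measurable_snd (measurable_seqTail hs)))

/-- The kernel predicting the future after a past `p` by conditioning the prediction made one step
earlier on the latest symbol of `p`. -/
noncomputable def updateKernel [Fintype A] (κ : Kernel (ℕ → A) (ℕ → A)) [IsFiniteKernel κ] :
    Kernel (ℕ → A) (ℕ → A) :=
  ⟨fun p => tailGivenHead (κ (seqTail p)) (p 0), measurable_tailGivenHead κ⟩

instance [Fintype A] (κ : Kernel (ℕ → A) (ℕ → A)) [IsFiniteKernel κ] :
    IsFiniteKernel (updateKernel κ) := by
  refine ⟨1, ENNReal.one_lt_top, fun p => ?_⟩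
  change tailGivenHead (κ (seqTail p)) (p 0) Set.univ ≤ 1
  rw [tailGivenHead, Measure.map_apply measurable_seqTail MeasurableSet.univ]
  exact prob_le_one

variable [Fintype A] [Nontrivial A]

lemma compProd_updateKernel (μ : Measure (ℤ → A)) [IsProbabilityMeasure μ] :
    μ.map (PastAt A 1) ⊗ₘ updateKernel (condDistrib (Future A) (Past A) μ) =
      μ.map (fun ω => (PastAt A 1 ω, Future A (shift A ω))) := by
  set κ := condDistrib (Future A) (Past A) μ with hκ
  have hdis (h : (ℕ → A) × (ℕ → A) → ENNReal) (hh : Measurable h) :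
      ∫⁻ ω, h (Past A ω, Future A ω) ∂μ =
        ∫⁻ p, ∫⁻ x, h (p, x) ∂κ p ∂(μ.map (Past A)) := by
    rw [← Measure.lintegral_compProd hh, hκ,
      compProd_map_condDistrib measurable_Future.aemeasurable,
      lintegral_map hh ((measurable_PastAt 0).prodMk measurable_Future)]
  have hcons : Measurable fun z : (ℕ → A) × (ℕ → A) => seqCons (z.2 0) z.1 :=
    measurable_seqCons.comp (g := fun z : A × (ℕ → A) => seqCons z.1 z.2)
      (((measurable_pi_apply (X := fun _ : ℕ => A) 0).comp measurable_snd).prodMk measurable_fst)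
  have hpair : Measurable fun ω : ℤ → A => (PastAt A 1 ω, Future A (shift A ω)) :=
    (measurable_PastAt 1).prodMk (measurable_Future.comp measurable_shift)
  ext E hE
  have hstep : Measurable fun z : (ℕ → A) × (ℕ → A) => (seqCons (z.2 0) z.1, seqTail z.2) :=
    hcons.prodMk (measurable_seqTail.comp measurable_snd)
  have hη := Kernel.measurable_kernel_prodMk_left (κ := updateKernel κ) hE
  rw [Measure.compProd_apply hE, lintegral_map hη (measurable_PastAt 1),
    Measure.map_apply hpair hE, ← lintegral_indicator_one (hpair hE)]
  have hL := hdis _ (hη.comp hcons)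
  have hR := hdis _ (measurable_one.indicator (hstep hE))
  simp only [Function.comp_def, ← PastAt_one] at hL
  rw [hL]
  refine Eq.trans (lintegral_congr fun p => ?_) (hR.symm.trans (lintegral_congr fun ω => ?_))
  · have hG (a : A) : MeasurableSet (Prod.mk (seqCons a p) ⁻¹' E) := measurable_prodMk_left hE
    have h1 := lintegral_tailGivenHead (κ p) hG
    have hm : MeasurableSet {x : ℕ → A | (seqCons (x 0) p, seqTail x) ∈ E} :=
      (hstep.comp (measurable_prodMk_left (x := p))) hE
    exact h1.trans (lintegral_indicator_one hm).symm
  · simp only [PastAt_one, Future_shift]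
    rfl

lemma causalState_zero_shift (μ : Measure (ℤ → A)) [IsProbabilityMeasure μ] (ω : ℤ → A) :
    causalState A μ 0 (shift A ω) = causalState A μ 1 ω := by
  simp only [causalState, PastAt_zero_shift]

lemma causalState_one_ae_eq (μ : Measure (ℤ → A)) [IsProbabilityMeasure μ]
    (hstat : μ.map (shift A) = μ) :
    ∀ᵐ ω ∂μ, causalState A μ 1 ω = tailGivenHead (causalState A μ 0 ω) (ω 0) := by
  have hjoint : μ.map (fun ω => (PastAt A 1 ω, Future A (shift A ω))) =
      μ.map (fun ω => (Past A ω, Future A ω)) := by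
    conv_rhs => rw [← hstat]
    rw [Measure.map_map ((measurable_PastAt 0).prodMk measurable_Future) measurable_shift]
    simp only [Function.comp_def, PastAt_zero_shift]
  have hpast : μ.map (PastAt A 1) = μ.map (Past A) := by
    conv_rhs => rw [← hstat]
    rw [Measure.map_map (measurable_PastAt 0) measurable_shift]
    simp only [Function.comp_def, PastAt_zero_shift]
  have h := condDistrib_ae_eq_of_measure_eq_compProd (Past A) measurable_Future.aemeasurable
    (κ := updateKernel (condDistrib (Future A) (Past A) μ))
    (by rw [← hjoint, ← compProd_updateKernel, hpast])
  rw [← hpast] at h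
  filter_upwards [ae_of_ae_map (measurable_PastAt 1).aemeasurable h] with ω hω
  refine hω.trans ?_
  change tailGivenHead (condDistrib (Future A) (Past A) μ (seqTail (PastAt A 1 ω)))
    (PastAt A 1 ω 0) = _
  rw [PastAt_one, seqTail_seqCons, seqCons_zero]
  rfl

end Determinism

/-- ε-machines are deterministic. -/
theorem epsilon_machines_deterministic
    {A : Type*} [Fintype A] [Nontrivial A] [MeasurableSpace A] [MeasurableSingletonClass A]
    (μ : Measure (ℤ → A)) [IsProbabilityMeasure μ]
    (hstat : μ.map (shift A) = μ)
    (hcount : (Set.range (causalState A μ 0)).Countable) :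
    ∃ f : Measure (ℕ → A) → A → Measure (ℕ → A),
      (∀ s ∈ Set.range (causalState A μ 0), ∀ a : A,
        f s a ∈ Set.range (causalState A μ 0)) ∧
      ∀ᵐ ω ∂μ, causalState A μ 1 ω = f (causalState A μ 0 ω) (ω 0) := by
  classical
  refine ⟨fun s a => if tailGivenHead s a ∈ Set.range (causalState A μ 0) then
    tailGivenHead s a else s, fun s hs a => ?_, ?_⟩
  · dsimp only
    split_ifs with h
    exacts [h, hs]
  · filter_upwards [causalState_one_ae_eq μ hstat] with ω hω
    rw [← hω, if_pos ⟨shift A ω, causalState_zero_shift μ ω⟩]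
end

section
/- The statistical complexity bounds the excess entropy: for all L ≥ 1 and M ≥ 1, the mutual information between a future block and a finite past block satisfies I[Future^L ; Past^M] ≤ C_μ = H[S_0]; hence the excess entropy E := sup_{L,M ≥ 1} I[Future^L ; Past^M] satisfies E ≤ C_μ. -/
open MeasureTheory ProbabilityTheory

/-- The level sets of a Markov kernel into a countably generated space are measurable. -/
theorem measurableSet_kernel_preimage_singleton {α β : Type*} [MeasurableSpace α]
    [MeasurableSpace β] [MeasurableSpace.CountablyGenerated β] (κ : Kernel α β) [IsMarkovKernel κ]
    (ν : Measure β) : MeasurableSet (κ ⁻¹' {ν}) := by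
  rcases (κ ⁻¹' {ν}).eq_empty_or_nonempty with h | ⟨a₀, ha₀⟩
  · rw [h]; exact MeasurableSet.empty
  obtain rfl : κ a₀ = ν := ha₀
  set 𝒞 := generateSetAlgebra (MeasurableSpace.countableGeneratingSet β) with h𝒞
  have hgen : ‹MeasurableSpace β› = MeasurableSpace.generateFrom 𝒞 := by
    rw [h𝒞, generateFrom_generateSetAlgebra_eq, MeasurableSpace.generateFrom_countableGeneratingSet]
  have hcount : 𝒞.Countable :=
    countable_generateSetAlgebra MeasurableSpace.countable_countableGeneratingSet
  have hmeas : ∀ s ∈ 𝒞, MeasurableSet s := fun s hs => by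
    rw [hgen]; exact MeasurableSpace.measurableSet_generateFrom hs
  have hpi : IsPiSystem 𝒞 := fun s hs t ht _ => isSetAlgebra_generateSetAlgebra.inter_mem hs ht
  have heq : κ ⁻¹' {κ a₀} = ⋂ s ∈ 𝒞, {a | κ a s = κ a₀ s} := by
    ext a
    simp only [Set.mem_preimage, Set.mem_singleton_iff, Set.mem_iInter, Set.mem_ofPred_eq]
    exact ⟨fun h s _ => by rw [h],
      fun h => ext_of_generate_finite 𝒞 hgen hpi h (by simp)⟩
  rw [heq]
  exact MeasurableSet.biInter hcount fun s hs =>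
    κ.measurable_coe (hmeas s hs) (measurableSet_singleton _)

/-- The law of total probability over the values of a random variable with countable range. -/
theorem hasSum_measureReal_inter_preimage_singleton {Ω R : Type*} [MeasurableSpace Ω]
    (μ : Measure Ω) [IsFiniteMeasure μ] {W : Ω → R} (hW : ∀ r, MeasurableSet (W ⁻¹' {r}))
    (hcount : (Set.range W).Countable) (B : Set Ω) :
    HasSum (fun r => μ.real (B ∩ W ⁻¹' {r})) (μ.real B) := by
  have : Countable (Set.range W) := hcount.to_subtype
  have hsupp : Function.support (fun r => μ.real (B ∩ W ⁻¹' {r})) ⊆ Set.range W := by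
    intro r hr
    by_contra hne
    refine hr ?_
    simp [Set.preimage_singleton_eq_empty.2 hne]
  rw [← hasSum_subtype_iff_of_support_subset hsupp]
  have hB : ∑' r : Set.range W, μ (B ∩ W ⁻¹' {(r : R)}) = μ B := by
    have hdisj : Pairwise (Function.onFun Disjoint fun r : Set.range W => W ⁻¹' {(r : R)}) :=
      fun r r' h => Disjoint.preimage _ (by simpa [Subtype.ext_iff] using h)
    have huniv : ⋃ r : Set.range W, W ⁻¹' {(r : R)} = Set.univ := by
      ext ω; simp
    have h := measure_iUnion (μ := μ.restrict B) hdisj fun r => hW r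
    rw [huniv, Measure.restrict_apply_univ] at h
    simp_rw [h, Measure.restrict_apply (hW _), Set.inter_comm B]
  have h := ENNReal.hasSum_toReal (hB ▸ measure_ne_top μ B)
  rwa [← ENNReal.tsum_toReal_eq fun r => measure_ne_top _ _, hB] at h

/-- A termwise form of the log-sum inequality. -/
theorem mul_log_div_le {x w p X Y : ℝ} (hx : 0 ≤ x) (hw : 0 ≤ w) (hX : 0 ≤ X) (hY : 0 ≤ Y)
    (hxX : x ≤ X) (hXY : Y = 0 → X = 0) (hxp : x ≤ p) (hxw : x * p ≤ w) :
    x * Real.log (X / Y) ≤ x * -Real.log p - x + w * (X / Y) := by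
  rcases hx.eq_or_lt with rfl | hx0
  · have : 0 ≤ w * (X / Y) := by positivity
    simpa using this
  have hX0 : 0 < X := hx0.trans_le hxX
  have hY0 : 0 < Y := hY.lt_of_ne fun h => hX0.ne' (hXY h.symm)
  have hp0 : 0 < p := hx0.trans_le hxp
  have hlog : Real.log (p * (X / Y)) ≤ w / x * (X / Y) - 1 :=
    calc Real.log (p * (X / Y)) ≤ p * (X / Y) - 1 := Real.log_le_sub_one_of_pos (by positivity)
      _ ≤ w / x * (X / Y) - 1 := by
        gcongr
        rwa [le_div_iff₀ hx0, mul_comm]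
  rw [Real.log_mul hp0.ne' (by positivity)] at hlog
  have h := mul_le_mul_of_nonneg_left hlog hx
  have hcancel : x * (w / x * (X / Y) - 1) = w * (X / Y) - x := by field_simp
  linarith

/-- If `U` and `V` are conditionally independent given `W`, then `I[U;V] ≤ H[W]`. -/
theorem mutInf_le_ent_of_condIndep {Ω S T R : Type*} [MeasurableSpace Ω] (μ : Measure Ω)
    [IsProbabilityMeasure μ] [Fintype S] [Fintype T] {U : Ω → S} {V : Ω → T} {W : Ω → R}
    (hU : ∀ s, MeasurableSet (U ⁻¹' {s})) (hV : ∀ t, MeasurableSet (V ⁻¹' {t}))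
    (hW : ∀ r, MeasurableSet (W ⁻¹' {r})) (hcount : (Set.range W).Countable)
    (hfin : entSummable μ W)
    (hindep : ∀ s t r, μ.real (U ⁻¹' {s} ∩ V ⁻¹' {t} ∩ W ⁻¹' {r}) * μ.real (W ⁻¹' {r}) =
      μ.real (U ⁻¹' {s} ∩ W ⁻¹' {r}) * μ.real (V ⁻¹' {t} ∩ W ⁻¹' {r})) :
    mutInf μ U V ≤ ent μ W := by
  have hsumU (B : Set Ω) : ∑ s, μ.real (B ∩ U ⁻¹' {s}) = μ.real B :=
    (hasSum_fintype _).unique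
      (hasSum_measureReal_inter_preimage_singleton μ hU (Set.to_countable _) B)
  have hsumV (B : Set Ω) : ∑ t, μ.real (B ∩ V ⁻¹' {t}) = μ.real B :=
    (hasSum_fintype _).unique
      (hasSum_measureReal_inter_preimage_singleton μ hV (Set.to_countable _) B)
  have hsumW := hasSum_measureReal_inter_preimage_singleton μ hW hcount
  have hlog2 : 0 < Real.log 2 := Real.log_pos one_lt_two
  have hterm (r : R) : -(μ.real (W ⁻¹' {r}) * Real.logb 2 (μ.real (W ⁻¹' {r}))) =
      μ.real (W ⁻¹' {r}) * -Real.log (μ.real (W ⁻¹' {r})) / Real.log 2 := by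
    rw [Real.logb]; ring
  have hlogW (r : R) : 0 ≤ -Real.log (μ.real (W ⁻¹' {r})) :=
    neg_nonneg.2 (Real.log_nonpos measureReal_nonneg measureReal_le_one)
  have hsW : Summable fun r => μ.real (W ⁻¹' {r}) * -Real.log (μ.real (W ⁻¹' {r})) := by
    have h := hfin.mul_right (Real.log 2)
    simp_rw [← measureReal_def, hterm, div_mul_cancel₀ _ hlog2.ne'] at h
    exact h
  have hsx (s : S) (t : T) : Summable fun r =>
      μ.real (U ⁻¹' {s} ∩ V ⁻¹' {t} ∩ W ⁻¹' {r}) * -Real.log (μ.real (W ⁻¹' {r})) :=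
    hsW.of_nonneg_of_le (fun r => mul_nonneg measureReal_nonneg (hlogW r)) fun r =>
      mul_le_mul_of_nonneg_right (measureReal_mono Set.inter_subset_right) (hlogW r)
  have hle (s : S) (t : T) : μ.real (U ⁻¹' {s} ∩ V ⁻¹' {t}) *
      Real.log (μ.real (U ⁻¹' {s} ∩ V ⁻¹' {t}) / (μ.real (U ⁻¹' {s}) * μ.real (V ⁻¹' {t}))) ≤
      ∑' r, μ.real (U ⁻¹' {s} ∩ V ⁻¹' {t} ∩ W ⁻¹' {r}) * -Real.log (μ.real (W ⁻¹' {r})) := by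
    set X := μ.real (U ⁻¹' {s} ∩ V ⁻¹' {t}) with hX
    set Y := μ.real (U ⁻¹' {s}) * μ.real (V ⁻¹' {t}) with hY
    have hXU : X ≤ μ.real (U ⁻¹' {s}) := measureReal_mono Set.inter_subset_left
    have hXV : X ≤ μ.real (V ⁻¹' {t}) := measureReal_mono Set.inter_subset_right
    have hX0 : 0 ≤ X := measureReal_nonneg
    have hXY : Y = 0 → X = 0 := fun h => by
      rcases mul_eq_zero.1 h with h | h <;> linarith
    have hx := hsumW (U ⁻¹' {s} ∩ V ⁻¹' {t})
    have hw := ((hsumW (U ⁻¹' {s})).mul_right (μ.real (V ⁻¹' {t}))).mul_right (X / Y)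
    have hYX : Y * (X / Y) = X := mul_div_cancel_of_imp' hXY
    have h := hasSum_le (fun r => mul_log_div_le (p := μ.real (W ⁻¹' {r}))
        (w := μ.real (U ⁻¹' {s} ∩ W ⁻¹' {r}) * μ.real (V ⁻¹' {t}))
        (X := X) (Y := Y) (x := μ.real (U ⁻¹' {s} ∩ V ⁻¹' {t} ∩ W ⁻¹' {r}))
        measureReal_nonneg (by positivity) hX0 (by positivity)
        (measureReal_mono Set.inter_subset_left) hXY (measureReal_mono Set.inter_subset_right)
        (by rw [hindep]; gcongr; exacts [measure_ne_top _ _, Set.inter_subset_left]))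
      (hx.mul_right _) (((hsx s t).hasSum.sub hx).add hw)
    linarith
  have hmarg : ∑ s, ∑ t, ∑' r, μ.real (U ⁻¹' {s} ∩ V ⁻¹' {t} ∩ W ⁻¹' {r}) *
      -Real.log (μ.real (W ⁻¹' {r})) =
      ∑' r, μ.real (W ⁻¹' {r}) * -Real.log (μ.real (W ⁻¹' {r})) := by
    simp_rw [← Summable.tsum_finsetSum fun t _ => hsx _ t]
    rw [← Summable.tsum_finsetSum fun s _ => summable_sum fun t _ => hsx s t]
    refine tsum_congr fun r => ?_
    simp_rw [← Finset.sum_mul]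
    congr 1
    calc ∑ s, ∑ t, μ.real (U ⁻¹' {s} ∩ V ⁻¹' {t} ∩ W ⁻¹' {r})
        = ∑ s, ∑ t, μ.real (W ⁻¹' {r} ∩ U ⁻¹' {s} ∩ V ⁻¹' {t}) := by
          simp_rw [Set.inter_comm _ (W ⁻¹' {r}), Set.inter_assoc]
      _ = μ.real (W ⁻¹' {r}) := by simp_rw [hsumV, hsumU]
  have hpair (q : S × T) : (fun ω => (U ω, V ω)) ⁻¹' {q} = U ⁻¹' {q.1} ∩ V ⁻¹' {q.2} := by
    ext ω; simp [Prod.ext_iff]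
  have hmut : mutInf μ U V = (∑ s, ∑ t, μ.real (U ⁻¹' {s} ∩ V ⁻¹' {t}) *
      Real.log (μ.real (U ⁻¹' {s} ∩ V ⁻¹' {t}) / (μ.real (U ⁻¹' {s}) * μ.real (V ⁻¹' {t})))) /
      Real.log 2 := by
    have hsplit (s : S) (t : T) : μ.real (U ⁻¹' {s} ∩ V ⁻¹' {t}) *
        Real.log (μ.real (U ⁻¹' {s} ∩ V ⁻¹' {t}) / (μ.real (U ⁻¹' {s}) * μ.real (V ⁻¹' {t}))) =
        μ.real (U ⁻¹' {s} ∩ V ⁻¹' {t}) * Real.log (μ.real (U ⁻¹' {s} ∩ V ⁻¹' {t})) -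
        μ.real (U ⁻¹' {s} ∩ V ⁻¹' {t}) * Real.log (μ.real (U ⁻¹' {s})) -
        μ.real (V ⁻¹' {t} ∩ U ⁻¹' {s}) * Real.log (μ.real (V ⁻¹' {t})) := by
      rw [Set.inter_comm (V ⁻¹' {t})]
      rcases (measureReal_nonneg (μ := μ) (s := U ⁻¹' {s} ∩ V ⁻¹' {t})).eq_or_lt with h | h
      · simp [← h]
      have hXU := h.trans_le (measureReal_mono (μ := μ) Set.inter_subset_left)
      have hXV := h.trans_le (measureReal_mono (μ := μ) Set.inter_subset_right)
      rw [Real.log_div h.ne' (by positivity), Real.log_mul hXU.ne' hXV.ne']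
      ring
    simp_rw [hsplit, Finset.sum_sub_distrib]
    rw [Finset.sum_comm (f := fun s t => μ.real (V ⁻¹' {t} ∩ U ⁻¹' {s}) * _)]
    simp_rw [← Finset.sum_mul, hsumU, hsumV]
    simp only [mutInf, ent, tsum_fintype, hpair, Fintype.sum_prod_type, ← measureReal_def,
      Real.logb, Finset.sum_neg_distrib, ← mul_div_assoc, ← Finset.sum_div]
    ring
  have hent : ent μ W =
      (∑' r, μ.real (W ⁻¹' {r}) * -Real.log (μ.real (W ⁻¹' {r}))) / Real.log 2 := by
    simp only [ent, ← measureReal_def, hterm, tsum_div_const]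
  rw [hmut, hent, ← hmarg]
  gcongr
  exact hle _ _

/-- Given the value of the conditional distribution of `Y` given `X`, the variables `Y` and `X`
are independent. -/
theorem condIndep_condDistrib {Ω β Γ : Type*} [MeasurableSpace Ω] [MeasurableSpace β]
    [MeasurableSpace Γ] [StandardBorelSpace Γ] [Nonempty Γ] (μ : Measure Ω) [IsFiniteMeasure μ]
    {X : Ω → β} {Y : Ω → Γ} (hX : Measurable X) (hY : Measurable Y) {C : Set Γ} {B : Set β}
    (hC : MeasurableSet C) (hB : MeasurableSet B) (ν : Measure Γ) :
    μ.real (Y ⁻¹' C ∩ X ⁻¹' B ∩ (fun ω => condDistrib Y X μ (X ω)) ⁻¹' {ν}) *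
        μ.real ((fun ω => condDistrib Y X μ (X ω)) ⁻¹' {ν}) =
      μ.real (Y ⁻¹' C ∩ (fun ω => condDistrib Y X μ (X ω)) ⁻¹' {ν}) *
        μ.real (X ⁻¹' B ∩ (fun ω => condDistrib Y X μ (X ω)) ⁻¹' {ν}) := by
  set E : Set β := condDistrib Y X μ ⁻¹' {ν} with hE
  have hEm : MeasurableSet E := measurableSet_kernel_preimage_singleton _ ν
  have hpre : (fun ω => condDistrib Y X μ (X ω)) ⁻¹' {ν} = X ⁻¹' E := rfl
  have hfactor {D : Set β} (hD : MeasurableSet D) (hDE : D ⊆ E) :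
      μ.real (Y ⁻¹' C ∩ X ⁻¹' D) = ν.real C * μ.real (X ⁻¹' D) := by
    simp only [measureReal_def, ← ENNReal.toReal_mul]
    rw [Set.inter_comm, ← setLIntegral_preimage_condDistrib hX hY.aemeasurable hC hD,
      setLIntegral_congr_fun (g := fun _ => ν C) (hX hD) fun ω hω => by
        rw [show condDistrib Y X μ (X ω) = ν from hDE hω],
      setLIntegral_const]
  rw [hpre, Set.inter_assoc, ← Set.preimage_inter, hfactor (hB.inter hEm) Set.inter_subset_right,
    hfactor hEm subset_rfl]
  ring

/-- the statistical complexity bounds the excess entropy. -/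
theorem statistical_complexity_bounds_excess_entropy
    {A : Type*} [Fintype A] [Nontrivial A] [MeasurableSpace A] [MeasurableSingletonClass A]
    (μ : Measure (ℤ → A)) [IsProbabilityMeasure μ]
    (hstat : μ.map (shift A) = μ)
    (hcount : (Set.range (causalState A μ 0)).Countable)
    (hfin : entSummable μ (causalState A μ 0)) :
    (∀ L M : ℕ, 1 ≤ L → 1 ≤ M →
      mutInf μ (FutureBlk A L) (PastBlk A M) ≤ ent μ (causalState A μ 0)) ∧
    (⨆ L : ℕ, ⨆ M : ℕ, mutInf μ (FutureBlk A (L + 1)) (PastBlk A (M + 1))) ≤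
      ent μ (causalState A μ 0) := by
  have hPast : Measurable (Past A) := by unfold Past PastAt; fun_prop
  have hFuture : Measurable (Future A) := by unfold Future; fun_prop
  have hblk (L M : ℕ) :
      mutInf μ (FutureBlk A L) (PastBlk A M) ≤ ent μ (causalState A μ 0) := by
    have hFut (s : Fin L → A) : ∃ C, MeasurableSet C ∧ FutureBlk A L ⁻¹' {s} = Future A ⁻¹' C := by
      refine ⟨(fun (x : ℕ → A) (i : Fin L) => x i) ⁻¹' {s}, ?_, rfl⟩
      exact (by fun_prop : Measurable fun (x : ℕ → A) (i : Fin L) => x i) (measurableSet_singleton s)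
    have hPst (t : Fin M → A) : ∃ B, MeasurableSet B ∧ PastBlk A M ⁻¹' {t} = Past A ⁻¹' B := by
      refine ⟨(fun (x : ℕ → A) (i : Fin M) => x (M - 1 - i)) ⁻¹' {t}, ?_, ?_⟩
      · exact (by fun_prop : Measurable fun (x : ℕ → A) (i : Fin M) => x (M - 1 - i))
          (measurableSet_singleton t)
      · rw [← Set.preimage_comp]
        congr 1
        funext ω i
        simp only [PastBlk, Past, PastAt, Function.comp_apply]
        congr 1
        omega
    refine mutInf_le_ent_of_condIndep μ (fun s => ?_) (fun t => ?_) (fun r => ?_) hcount hfin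
      fun s t r => ?_
    · obtain ⟨C, hC, h⟩ := hFut s
      exact h ▸ hFuture hC
    · obtain ⟨B, hB, h⟩ := hPst t
      exact h ▸ hPast hB
    · exact hPast (measurableSet_kernel_preimage_singleton (condDistrib (Future A) (Past A) μ) r)
    · obtain ⟨C, hC, h⟩ := hFut s
      obtain ⟨B, hB, h'⟩ := hPst t
      rw [h, h']
      exact condIndep_condDistrib μ hPast hFuture hC hB r
  exact ⟨fun L M _ _ => hblk L M, ciSup_le fun L => ciSup_le fun M => hblk (L + 1) (M + 1)⟩
end

section
/- Given the causal state, the future is conditionally independent of the past: for every L ≥ 1 and M ≥ 1, the future block Future^L and the finite past Past^M are conditionally independent given S_0; equivalently, H[Future^L | S_0, Past^M] = H[Future^L | S_0]. -/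
open MeasureTheory ProbabilityTheory

/-- A finite kernel into a standard Borel space takes each given value on a measurable set. -/
lemma measurableSet_kernel_eq {α β : Type*} [MeasurableSpace α] [MeasurableSpace β]
    [StandardBorelSpace β] (κ : Kernel α β) [IsFiniteKernel κ] (ν : Measure β) :
    MeasurableSet {x | κ x = ν} := by
  by_cases hν : IsFiniteMeasure ν
  · let e := embeddingReal β
    have he : MeasurableEmbedding e := measurableEmbedding_embeddingReal β
    have h_eq : {x | κ x = ν} =
        ⋂ a : ℚ, ⋂ b : ℚ, {x | κ x (e ⁻¹' Set.Ioo (a : ℝ) b) = ν (e ⁻¹' Set.Ioo (a : ℝ) b)} := by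
      ext x
      simp only [Set.mem_ofPred_eq, Set.mem_iInter]
      refine ⟨fun h a b => by rw [h], fun h => ?_⟩
      have h_map : (κ x).map e = ν.map e := by
        refine Real.measure_ext_Ioo_rat fun a b => ?_
        rw [he.map_apply, he.map_apply, h a b]
      rw [← he.comap_map (κ x), h_map, he.comap_map]
    rw [h_eq]
    exact .iInter fun a => .iInter fun b =>
      κ.measurable_coe (he.measurable measurableSet_Ioo) (measurableSet_singleton _)
  · convert MeasurableSet.empty
    ext x
    simp only [Set.mem_ofPred_eq, Set.mem_empty_iff_false, iff_false]
    rintro rfl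
    exact hν inferInstance

/-- The entropy of `U` as a series of values of `Real.negMulLog`. -/
lemma ent_eq_tsum_negMulLog {Ω S : Type*} [MeasurableSpace Ω] (μ : Measure Ω) (U : Ω → S) :
    ent μ U = (∑' s, (μ.real (U ⁻¹' {s})).negMulLog) / Real.log 2 := by
  rw [ent, ← tsum_div_const]
  refine tsum_congr fun s => ?_
  simp only [Real.negMulLog, Real.logb, Measure.real]
  ring

lemma entSummable_iff_negMulLog {Ω S : Type*} [MeasurableSpace Ω] {μ : Measure Ω} {U : Ω → S} :
    entSummable μ U ↔ Summable fun s => (μ.real (U ⁻¹' {s})).negMulLog := by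
  rw [entSummable, ← summable_div_const_iff (f := fun s => (μ.real (U ⁻¹' {s})).negMulLog)
    (Real.log_pos one_lt_two).ne']
  refine summable_congr fun s => ?_
  simp only [Real.negMulLog, Real.logb, Measure.real]
  ring

lemma summable_measureReal_preimage_singleton {Ω T : Type*} [MeasurableSpace Ω] (μ : Measure Ω)
    [IsFiniteMeasure μ] {V : Ω → T} (hV : ∀ t, MeasurableSet (V ⁻¹' {t})) :
    Summable fun t => μ.real (V ⁻¹' {t}) := by
  refine ENNReal.summable_toReal (ne_top_of_le_ne_top (measure_ne_top μ Set.univ) ?_)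
  refine (tsum_meas_le_meas_iUnion_of_disjoint μ hV fun s t hst => ?_).trans
    (measure_mono (Set.subset_univ _))
  exact Disjoint.preimage V (Set.disjoint_singleton.2 hst)

/-- Rescaling the weights `v` of finite entropy by factors in `[0, 1]` preserves finiteness of the
entropy. -/
lemma summable_negMulLog_mul {T : Type*} {v q : T → ℝ}
    (hv : Summable v) (hv0 : ∀ t, 0 ≤ v t) (hv1 : ∀ t, v t ≤ 1)
    (hvlog : Summable fun t => (v t).negMulLog)
    (hq0 : ∀ t, 0 ≤ q t) (hq1 : ∀ t, q t ≤ 1) :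
    Summable fun t => (q t * v t).negMulLog := by
  refine Summable.of_nonneg_of_le (fun t => ?_) (fun t => ?_) (hv.add hvlog)
  · exact Real.negMulLog_nonneg (mul_nonneg (hq0 t) (hv0 t))
      (mul_le_one₀ (hq1 t) (hv0 t) (hv1 t))
  · rw [Real.negMulLog_mul]
    have h1 := (Real.negMulLog_le_one_sub_self (hq0 t)).trans (sub_le_self 1 (hq0 t))
    have h2 := Real.negMulLog_nonneg (hv0 t) (hv1 t)
    exact add_le_add (mul_le_of_le_one_right (hv0 t) h1) (mul_le_of_le_one_left h2 (hq1 t))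

lemma measureReal_preimage_prod {Ω S T : Type*} [MeasurableSpace Ω] (μ : Measure Ω)
    (U : Ω → S) (V : Ω → T) (s : S) (t : T) :
    μ.real ((fun ω => (U ω, V ω)) ⁻¹' {(s, t)}) = μ.real (U ⁻¹' {s} ∩ V ⁻¹' {t}) := by
  congr 1
  ext ω
  simp

lemma sum_measureReal_preimage_inter {Ω F : Type*} [MeasurableSpace Ω] [Fintype F]
    (μ : Measure Ω) [IsFiniteMeasure μ] {U : Ω → F} (hU : ∀ f, MeasurableSet (U ⁻¹' {f}))
    (B : Set Ω) : ∑ f, μ.real (U ⁻¹' {f} ∩ B) = μ.real B := by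
  classical
  simp_rw [← measureReal_restrict_apply (hU _)]
  rw [sum_measureReal_preimage_singleton _ fun f _ => hU f]
  simp

/-- Adjoining a finite-valued variable preserves finiteness of entropy. -/
lemma entSummable_prod_of_finite {Ω F T : Type*} [MeasurableSpace Ω] [Finite F] {μ : Measure Ω}
    [IsProbabilityMeasure μ] {V : Ω → T} (hV : ∀ t, MeasurableSet (V ⁻¹' {t}))
    (hVent : entSummable μ V) (U : Ω → F) :
    entSummable μ fun ω => (V ω, U ω) := by
  rw [entSummable_iff_negMulLog] at hVent ⊢
  rw [← (Equiv.prodComm F T).summable_iff]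
  refine (summable_prod_of_nonneg fun _ =>
    Real.negMulLog_nonneg measureReal_nonneg measureReal_le_one).2 ⟨fun f => ?_, Summable.of_finite⟩
  simp only [Equiv.prodComm_apply, Prod.swap_prod_mk, measureReal_preimage_prod]
  refine (summable_negMulLog_mul (q := fun t => μ.real (V ⁻¹' {t} ∩ U ⁻¹' {f}) /
    μ.real (V ⁻¹' {t})) (summable_measureReal_preimage_singleton μ hV)
    (fun _ => measureReal_nonneg) (fun _ => measureReal_le_one) hVent
    (fun _ => by positivity) (fun _ => div_le_one_of_le₀
      (measureReal_mono Set.inter_subset_left) measureReal_nonneg)).congr fun t => ?_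
  congr 1
  exact div_mul_cancel_of_imp fun h =>
    measureReal_mono_null Set.inter_subset_left h

/-- The conditional entropy of a finite-valued variable as the average of the entropies of its
conditional laws. -/
lemma condEnt_eq_tsum {Ω F T : Type*} [MeasurableSpace Ω] [Fintype F] {μ : Measure Ω}
    [IsProbabilityMeasure μ] {U : Ω → F} {V : Ω → T} (hV : ∀ t, MeasurableSet (V ⁻¹' {t}))
    (hVent : entSummable μ V) (hU : ∀ f, MeasurableSet (U ⁻¹' {f})) {q : F → T → ℝ}
    (hq0 : ∀ f t, 0 ≤ q f t) (hq1 : ∀ f t, q f t ≤ 1)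
    (hq : ∀ f t, μ.real (U ⁻¹' {f} ∩ V ⁻¹' {t}) = q f t * μ.real (V ⁻¹' {t})) :
    condEnt μ U V = (∑' t, μ.real (V ⁻¹' {t}) * ∑ f, (q f t).negMulLog) / Real.log 2 := by
  rw [entSummable_iff_negMulLog] at hVent
  set v : T → ℝ := fun t => μ.real (V ⁻¹' {t}) with hv_def
  have hv : Summable v := summable_measureReal_preimage_singleton μ hV
  have hv0 (t : T) : 0 ≤ v t := measureReal_nonneg
  have h_joint (f : F) : Summable fun t => (q f t * v t).negMulLog :=
    summable_negMulLog_mul hv hv0 (fun _ => measureReal_le_one) hVent (hq0 f) (hq1 f)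
  have h_sum (t : T) : ∑ f, q f t * v t = v t := by
    simp_rw [hv_def, ← hq]
    exact sum_measureReal_preimage_inter μ hU _
  have h_split (t : T) :
      ∑ f, (q f t * v t).negMulLog - (v t).negMulLog = v t * ∑ f, (q f t).negMulLog := by
    have h_log : ∑ f, q f t * (v t).negMulLog = (v t).negMulLog := by
      simp only [Real.negMulLog, ← mul_assoc, mul_neg, neg_mul]
      rw [Finset.sum_neg_distrib, ← Finset.sum_mul, h_sum]
    simp_rw [Real.negMulLog_mul]
    rw [Finset.sum_add_distrib, h_log, Finset.mul_sum, add_sub_cancel_right]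
  have h_prod : Summable fun p : F × T => (q p.1 p.2 * v p.2).negMulLog := by
    rw [summable_prod_of_nonneg fun p => Real.negMulLog_nonneg
      (mul_nonneg (hq0 p.1 p.2) (hv0 p.2))
      (mul_le_one₀ (hq1 p.1 p.2) (hv0 p.2) measureReal_le_one)]
    exact ⟨h_joint, Summable.of_finite⟩
  have h_pair : ∑' p : F × T, (μ.real ((fun ω => (U ω, V ω)) ⁻¹' {p})).negMulLog =
      ∑' t, ∑ f, (q f t * v t).negMulLog := by
    rw [Summable.tsum_finsetSum fun f _ => h_joint f,
      ← tsum_fintype (L := .unconditional F), ← h_prod.tsum_prod]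
    refine tsum_congr fun p => ?_
    rw [measureReal_preimage_prod, hq]
  rw [condEnt, ent_eq_tsum_negMulLog, ent_eq_tsum_negMulLog, ← sub_div, h_pair,
    ← (summable_sum fun f _ => h_joint f).tsum_sub hVent]
  exact congrArg (· / Real.log 2) (tsum_congr h_split)

/-- If the conditional law of `U` given `(V, W)` depends on `V` only, then conditioning on `(V, W)`
gives the same conditional entropy as conditioning on `V`. -/
lemma condEnt_prod_eq_of_factor {Ω F G T : Type*} [MeasurableSpace Ω] [Fintype F] [Fintype G]
    {μ : Measure Ω} [IsProbabilityMeasure μ] {U : Ω → F} {V : Ω → T} {W : Ω → G}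
    (hV : ∀ t, MeasurableSet (V ⁻¹' {t})) (hVent : entSummable μ V)
    (hU : ∀ f, MeasurableSet (U ⁻¹' {f})) (hW : ∀ g, MeasurableSet (W ⁻¹' {g})) {q : F → T → ℝ}
    (hq0 : ∀ f t, 0 ≤ q f t) (hq1 : ∀ f t, q f t ≤ 1)
    (hq : ∀ f t g, μ.real (U ⁻¹' {f} ∩ (V ⁻¹' {t} ∩ W ⁻¹' {g})) =
      q f t * μ.real (V ⁻¹' {t} ∩ W ⁻¹' {g})) :
    condEnt μ U (fun ω => (V ω, W ω)) = condEnt μ U V := by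
  have h_pre (p : T × G) :
      (fun ω => (V ω, W ω)) ⁻¹' {p} = V ⁻¹' {p.1} ∩ W ⁻¹' {p.2} := by
    ext ω
    simp [Prod.ext_iff]
  have h_marg (B : Set Ω) : ∑ g, μ.real (B ∩ W ⁻¹' {g}) = μ.real B := by
    simp_rw [Set.inter_comm B]
    exact sum_measureReal_preimage_inter μ hW B
  have hVW (p : T × G) : MeasurableSet ((fun ω => (V ω, W ω)) ⁻¹' {p}) := by
    rw [h_pre]
    exact (hV _).inter (hW _)
  rw [condEnt_eq_tsum hVW (entSummable_prod_of_finite hV hVent W) hU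
      (q := fun f p => q f p.1) (fun f p => hq0 f p.1) (fun f p => hq1 f p.1)
      (fun f p => by rw [h_pre, hq]),
    condEnt_eq_tsum hV hVent hU hq0 hq1 fun f t => by
      rw [← h_marg (V ⁻¹' {t}), ← h_marg (U ⁻¹' {f} ∩ V ⁻¹' {t}), Finset.mul_sum]
      exact Finset.sum_congr rfl fun g _ => by rw [Set.inter_assoc, hq]]
  congr 1
  have h_bound (t : T) (f : F) : 0 ≤ (q f t).negMulLog ∧ (q f t).negMulLog ≤ 1 :=
    ⟨Real.negMulLog_nonneg (hq0 f t) (hq1 f t),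
      (Real.negMulLog_le_one_sub_self (hq0 f t)).trans (sub_le_self 1 (hq0 f t))⟩
  have h_summable : Summable fun p : T × G =>
      μ.real ((fun ω => (V ω, W ω)) ⁻¹' {p}) * ∑ f, (q f p.1).negMulLog := by
    refine Summable.of_nonneg_of_le (fun p => mul_nonneg measureReal_nonneg
      (Finset.sum_nonneg fun f _ => (h_bound p.1 f).1)) (fun p => ?_)
      ((summable_measureReal_preimage_singleton μ hVW).mul_right (Fintype.card F : ℝ))
    refine mul_le_mul_of_nonneg_left ?_ measureReal_nonneg
    exact (Finset.sum_le_sum fun f _ => (h_bound p.1 f).2).trans_eq (by simp)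
  rw [h_summable.tsum_prod]
  refine tsum_congr fun t => ?_
  simp_rw [tsum_fintype, h_pre]
  rw [← Finset.sum_mul, h_marg]

/-- On a past event inside a fibre of the causal state, the future is distributed according to
that state. -/
lemma measure_inter_future_of_subset_causalState {A : Type*} [Fintype A] [Nontrivial A]
    [MeasurableSpace A] [MeasurableSingletonClass A] (μ : Measure (ℤ → A)) [IsFiniteMeasure μ]
    (ν : Measure (ℕ → A)) {B : Set (ℤ → A)}
    (hB : MeasurableSet[MeasurableSpace.comap (Past A) inferInstance] B)
    (hBν : B ⊆ causalState A μ 0 ⁻¹' {ν}) {E : Set (ℕ → A)} (hE : MeasurableSet E) :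
    μ (Future A ⁻¹' E ∩ B) = ν E * μ B := by
  have hPast : Measurable (Past A) := measurable_pi_lambda _ fun n => measurable_pi_apply _
  have hFuture : Measurable (Future A) := measurable_pi_lambda _ fun n => measurable_pi_apply _
  rw [Set.inter_comm,
    ← setLIntegral_condDistrib_of_measurableSet hPast hFuture.aemeasurable hE hB,
    setLIntegral_congr_fun (hPast.comap_le _ hB) (g := fun _ => ν E) fun ω hω => ?_,
    setLIntegral_const]
  exact congrArg (fun m : Measure (ℕ → A) => m E) (hBν hω)

/-- given the causal state, the future is conditionally
independent of the past. -/
theorem future_cond_indep_past_given_causal_state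
    {A : Type*} [Fintype A] [Nontrivial A] [MeasurableSpace A] [MeasurableSingletonClass A]
    (μ : Measure (ℤ → A)) [IsProbabilityMeasure μ]
    (hstat : μ.map (shift A) = μ)
    (hcount : (Set.range (causalState A μ 0)).Countable)
    (hfin : entSummable μ (causalState A μ 0))
    (L M : ℕ) (hL : 1 ≤ L) (hM : 1 ≤ M) :
    condEnt μ (FutureBlk A L) (fun ω => (causalState A μ 0 ω, PastBlk A M ω)) =
      condEnt μ (FutureBlk A L) (causalState A μ 0) := by
  classical
  have hPast : Measurable (Past A) := measurable_pi_lambda _ fun n => measurable_pi_apply _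
  have hFutureBlk : Measurable (FutureBlk A L) :=
    measurable_pi_lambda _ fun i => measurable_pi_apply _
  have hState (ν : Measure (ℕ → A)) :
      MeasurableSet[MeasurableSpace.comap (Past A) inferInstance] (causalState A μ 0 ⁻¹' {ν}) :=
    ⟨_, measurableSet_kernel_eq (condDistrib (Future A) (Past A) μ) ν, rfl⟩
  have hPastBlk (p : Fin M → A) :
      MeasurableSet[MeasurableSpace.comap (Past A) inferInstance] (PastBlk A M ⁻¹' {p}) := by
    let g : (ℕ → A) → Fin M → A := fun x i => x (M - 1 - i)
    have hg : Measurable g := measurable_pi_lambda _ fun i => measurable_pi_apply _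
    refine ⟨g ⁻¹' {p}, hg (measurableSet_singleton p), ?_⟩
    rw [← Set.preimage_comp]
    congr 1
    ext ω i
    simp only [g, Function.comp_apply, PastAt, PastBlk]
    congr 1
    have := i.isLt
    omega
  let E (f : Fin L → A) : Set (ℕ → A) := (fun x (i : Fin L) => x i) ⁻¹' {f}
  have hE (f : Fin L → A) : MeasurableSet (E f) :=
    (measurable_pi_lambda _ fun i => measurable_pi_apply _ : Measurable
      fun (x : ℕ → A) (i : Fin L) => x i) (measurableSet_singleton f)
  have hEF (f : Fin L → A) : FutureBlk A L ⁻¹' {f} = Future A ⁻¹' E f := rfl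
  -- States outside the range have empty fibres, so their weights may be replaced by zero.
  refine condEnt_prod_eq_of_factor
    (q := fun f ν => if IsProbabilityMeasure ν then ν.real (E f) else 0)
    (fun ν => hPast.comap_le _ (hState ν)) hfin
    (fun f => hFutureBlk (measurableSet_singleton f))
    (fun p => hPast.comap_le _ (hPastBlk p)) (fun f ν => ?_) (fun f ν => ?_) (fun f ν p => ?_)
  · split_ifs
    exacts [measureReal_nonneg, le_rfl]
  · split_ifs
    exacts [measureReal_le_one, zero_le_one]
  · rw [hEF, Measure.real, measure_inter_future_of_subset_causalState μ ν
      (@MeasurableSet.inter _ (_) _ _ (hState ν) (hPastBlk p)) Set.inter_subset_left (hE f), ENNReal.toReal_mul]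
    split_ifs with hν
    · rfl
    · have h_empty : causalState A μ 0 ⁻¹' {ν} = ∅ := by
        rw [Set.eq_empty_iff_forall_notMem]
        rintro ω rfl
        exact hν (inferInstanceAs
          (IsProbabilityMeasure (condDistrib (Future A) (Past A) μ (PastAt A 0 ω))))
      simp [h_empty]
end
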